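/- Upper bound via the translated radial competitor: with hypotheses as in the main theorem, χoose p ∈ ℝ² such that ∫_Ω f_ε(|x − p|)(x − p)/|x − p| dx = 0, where f_ε extends f̃_ε by 1 outside [0,1]. Then φ_ε(x) = f_ε(|x − p|)(x − p)/|x − p| belongs to K and E_ε(φ_ε, Ω) ≤ E_ε(ũ_ε, B₁). -/

import Mathlib

open Set MeasureTheory

lemma monotoneOn_Ioo_of_hasDerivAt {g g' : ℝ → ℝ} {a b : ℝ}
    (h : ∀ r ∈ Ioo a b, HasDerivAt g (g' r) r) (h0 : ∀ r ∈ Ioo a b, 0 ≤ g' r) :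
    MonotoneOn g (Ioo a b) := by
  refine monotoneOn_of_hasDerivWithinAt_nonneg (convex_Ioo a b)
    (fun r hr => (h r hr).continuousAt.continuousWithinAt) (f' := g') ?_ ?_
  · intro r hr
    rw [interior_Ioo] at hr
    exact (h r hr).hasDerivWithinAt
  · intro r hr
    rw [interior_Ioo] at hr
    exact h0 r hr

/-- A nondecreasing `[0, 1]`-valued solution `f` (with derivative `d`) on `(0, 1)` of the radial
Ginzburg-Landau equation of degree one. -/
structure IsRadialProfile (k : ℝ) (f d : ℝ → ℝ) : Prop where
  nonneg_coeff : 0 ≤ k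
  nonneg : ∀ r ∈ Ioo (0:ℝ) 1, 0 ≤ f r
  le_one : ∀ r ∈ Ioo (0:ℝ) 1, f r ≤ 1
  deriv_nonneg : ∀ r ∈ Ioo (0:ℝ) 1, 0 ≤ d r
  hasDerivAt : ∀ r ∈ Ioo (0:ℝ) 1, HasDerivAt f (d r) r
  hasDerivAt_deriv : ∀ r ∈ Ioo (0:ℝ) 1,
    HasDerivAt d (-(d r) / r + f r / r ^ 2 - k * f r * (1 - f r ^ 2)) r
  tendsto_one : Filter.Tendsto f (nhdsWithin 1 (Iio 1)) (nhds 1)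

namespace IsRadialProfile

variable {k : ℝ} {f d : ℝ → ℝ}

lemma nonneg_reaction (h : IsRadialProfile k f d) {r : ℝ} (hr : r ∈ Ioo (0:ℝ) 1) :
    0 ≤ k * f r * (1 - f r ^ 2) := by
  have h0 := h.nonneg r hr
  have h1 := h.le_one r hr
  have := h.nonneg_coeff
  have : 0 ≤ 1 - f r ^ 2 := by nlinarith
  positivity

lemma reaction_le (h : IsRadialProfile k f d) {r : ℝ} (hr : r ∈ Ioo (0:ℝ) 1) :
    k * f r * (1 - f r ^ 2) ≤ k := by
  have h0 := h.nonneg r hr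
  have h1 := h.le_one r hr
  have h2 : f r * (1 - f r ^ 2) ≤ 1 := by nlinarith [sq_nonneg (f r), pow_nonneg h0 3]
  nlinarith [h.nonneg_coeff]

lemma hasDerivAt_div (h : IsRadialProfile k f d) {r : ℝ} (hr : r ∈ Ioo (0:ℝ) 1) :
    HasDerivAt (fun r => f r / r) ((r ^ 2 * d r - r * f r) / r ^ 3) r := by
  have hr0 : r ≠ 0 := hr.1.ne'
  refine ((h.hasDerivAt r hr).div (hasDerivAt_id r) hr0).congr_deriv ?_
  simp only [id]
  field_simp

lemma hasDerivAt_flux (h : IsRadialProfile k f d) {r : ℝ} (hr : r ∈ Ioo (0:ℝ) 1) :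
    HasDerivAt (fun r => r ^ 2 * d r - r * f r) (-(r ^ 2 * (k * f r * (1 - f r ^ 2)))) r := by
  have hr0 : r ≠ 0 := hr.1.ne'
  refine (((hasDerivAt_pow 2 r).mul (h.hasDerivAt_deriv r hr)).sub
    ((hasDerivAt_id r).mul (h.hasDerivAt r hr))).congr_deriv ?_
  simp only [id]
  field_simp
  push_cast
  ring

lemma flux_nonpos (h : IsRadialProfile k f d) {r : ℝ} (hr : r ∈ Ioo (0:ℝ) 1) :
    r ^ 2 * d r - r * f r ≤ 0 := by
  by_contra! hc
  set c := r ^ 2 * d r - r * f r with hcdef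
  have hsub : ∀ s ∈ Ioo 0 r, s ∈ Ioo (0:ℝ) 1 := fun s hs => ⟨hs.1, hs.2.trans hr.2⟩
  have hanti : ∀ s ∈ Ioo 0 r, c ≤ s ^ 2 * d s - s * f s := by
    intro s hs
    have hm := monotoneOn_Ioo_of_hasDerivAt (a := 0) (b := 1)
      (fun r hr => (h.hasDerivAt_flux hr).neg)
      (fun r hr => by have := h.nonneg_reaction hr; rw [neg_neg]; positivity)
    have := hm (hsub s hs) hr hs.2.le
    simp only [Pi.neg_apply] at this
    linarith
  have hmono : MonotoneOn (fun s => f s / s - c / 2 * (-(s ^ 2)⁻¹)) (Ioo 0 r) := by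
    refine monotoneOn_Ioo_of_hasDerivAt
      (g' := fun s => (s ^ 2 * d s - s * f s - c) / s ^ 3) ?_ ?_
    · intro s hs
      have hs0 : s ≠ 0 := hs.1.ne'
      refine ((h.hasDerivAt_div (hsub s hs)).sub
        ((((hasDerivAt_pow 2 s).inv (pow_ne_zero 2 hs0)).neg).const_mul (c / 2))).congr_deriv ?_
      field_simp
      push_cast
      ring
    · intro s hs
      have := hanti s hs
      have := hs.1
      apply div_nonneg <;> [linarith; positivity]
  have hr2 : r / 2 ∈ Ioo 0 r := ⟨by linarith [hr.1], by linarith [hr.1]⟩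
  set M := f (r / 2) / (r / 2) - c / 2 * (-((r / 2) ^ 2)⁻¹) with hM
  have hle : ∀ s ∈ Ioo 0 (r / 2), c / 2 ≤ M * s ^ 2 := by
    intro s hs
    have hs' : s ∈ Ioo 0 r := ⟨hs.1, hs.2.trans hr2.2⟩
    have h1 := hmono hs' hr2 hs.2.le
    simp only at h1
    have hs0 := hs.1
    have h2 : 0 ≤ f s / s := div_nonneg (h.nonneg s (hsub s hs')) hs0.le
    have h3 : c / 2 * (s ^ 2)⁻¹ ≤ M := by linarith
    calc c / 2 = c / 2 * (s ^ 2)⁻¹ * s ^ 2 := by field_simp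
      _ ≤ M * s ^ 2 := by gcongr
  have hlim : Filter.Tendsto (fun s : ℝ => M * s ^ 2) (nhdsWithin 0 (Ioi 0)) (nhds 0) := by
    have : Continuous fun s : ℝ => M * s ^ 2 := by fun_prop
    simpa using (this.tendsto 0).mono_left nhdsWithin_le_nhds
  have := ge_of_tendsto hlim
    (Filter.eventually_of_mem (Ioo_mem_nhdsGT (by linarith [hr.1] : (0:ℝ) < r / 2)) hle)
  linarith

lemma neg_le_flux (h : IsRadialProfile k f d) {r : ℝ} (hr : r ∈ Ioo (0:ℝ) 1) :
    -(k / 3 * r ^ 3) ≤ r ^ 2 * d r - r * f r := by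
  have hmono : MonotoneOn (fun s => s ^ 2 * d s - s * f s + k / 3 * s ^ 3) (Ioo 0 1) := by
    refine monotoneOn_Ioo_of_hasDerivAt
      (g' := fun s => s ^ 2 * (k - k * f s * (1 - f s ^ 2))) ?_ ?_
    · intro s hs
      refine ((h.hasDerivAt_flux hs).add
        ((hasDerivAt_pow 3 s).const_mul (k / 3))).congr_deriv ?_
      push_cast
      ring
    · intro s hs
      have := h.reaction_le hs
      exact mul_nonneg (sq_nonneg s) (by linarith)
  have hlim : Filter.Tendsto (fun s : ℝ => -s) (nhdsWithin 0 (Ioi 0)) (nhds 0) := by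
    simpa using (continuous_neg.tendsto (0:ℝ)).mono_left nhdsWithin_le_nhds
  have := le_of_tendsto hlim (Filter.eventually_of_mem (Ioo_mem_nhdsGT hr.1)
    (fun s hs => show -s ≤ r ^ 2 * d r - r * f r + k / 3 * r ^ 3 from ?_))
  · linarith
  · have hs' : s ∈ Ioo (0:ℝ) 1 := ⟨hs.1, hs.2.trans hr.2⟩
    have h1 := hmono hs' hr hs.2.le
    simp only at h1
    have hs0 := hs.1
    have h2 := h.deriv_nonneg s hs'
    have h3 := h.le_one s hs'
    have hk := h.nonneg_coeff
    have : 0 ≤ s ^ 2 * d s := by positivity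
    have : 0 ≤ k / 3 * s ^ 3 := by positivity
    nlinarith

lemma div_le (h : IsRadialProfile k f d) {r : ℝ} (hr : r ∈ Ioo (0:ℝ) 1) :
    f r / r ≤ 1 + k / 3 := by
  have hmono : MonotoneOn (fun s => f s / s + k / 3 * s) (Ioo 0 1) := by
    refine monotoneOn_Ioo_of_hasDerivAt
      (fun s hs => (h.hasDerivAt_div hs).add ((hasDerivAt_id s).const_mul (k / 3))) ?_
    intro s hs
    have hs0 := hs.1
    have := h.neg_le_flux hs
    have : -(k / 3) ≤ (s ^ 2 * d s - s * f s) / s ^ 3 := by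
      rw [le_div_iff₀ (by positivity)]
      linarith
    linarith
  have hlim : Filter.Tendsto (fun s : ℝ => f s / s + k / 3 * s) (nhdsWithin 1 (Iio 1))
      (nhds (1 / 1 + k / 3 * 1)) := by
    have hid : Filter.Tendsto (fun s : ℝ => s) (nhdsWithin 1 (Iio 1)) (nhds 1) :=
      Filter.tendsto_id.mono_left nhdsWithin_le_nhds
    exact (h.tendsto_one.div hid one_ne_zero).add (hid.const_mul _)
  have := ge_of_tendsto hlim (Filter.eventually_of_mem (Ioo_mem_nhdsLT hr.2)
    (fun s hs => hmono hr ⟨hr.1.trans hs.1, hs.2⟩ hs.1.le))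
  have hk := h.nonneg_coeff
  have := mul_nonneg (div_nonneg hk (by norm_num : (0:ℝ) ≤ 3)) hr.1.le
  simp only at *
  linarith

lemma deriv_le_div (h : IsRadialProfile k f d) {r : ℝ} (hr : r ∈ Ioo (0:ℝ) 1) :
    d r ≤ f r / r := by
  have := h.flux_nonpos hr
  have hr0 := hr.1
  rw [le_div_iff₀ hr0]
  by_contra! hc
  nlinarith [mul_pos hr0 (sub_pos.2 hc)]

/-- The energy density of a radial profile is at least its boundary value `1`. -/
lemma one_le_energy (h : IsRadialProfile k f d) {r : ℝ} (hr : r ∈ Ioo (0:ℝ) 1) :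
    1 ≤ d r ^ 2 + (f r / r) ^ 2 + k / 2 * (f r ^ 2 - 1) ^ 2 := by
  have hmono : MonotoneOn
      (fun s => -(d s ^ 2 + (f s / s) ^ 2 + k / 2 * (f s ^ 2 - 1) ^ 2)) (Ioo 0 1) := by
    refine monotoneOn_Ioo_of_hasDerivAt
      (g' := fun s => 2 / s * (d s - f s / s) ^ 2 + 4 * d s * (k * f s * (1 - f s ^ 2))) ?_ ?_
    · intro s hs
      have hs0 : s ≠ 0 := hs.1.ne'
      have hf := h.hasDerivAt s hs
      refine (((((h.hasDerivAt_deriv s hs).pow 2).add ((h.hasDerivAt_div hs).pow 2)).add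
        ((((hf.pow 2).sub_const 1).pow 2).const_mul (k / 2))).neg).congr_deriv ?_
      simp only [Pi.pow_apply, Nat.add_one_sub_one, pow_one, Nat.cast_ofNat]
      field_simp
      ring
    · intro s hs
      have := h.nonneg_reaction hs
      have := h.deriv_nonneg s hs
      have := hs.1
      positivity
  have hlim : Filter.Tendsto (fun s : ℝ => (f s / s) ^ 2) (nhdsWithin 1 (Iio 1))
      (nhds ((1 / 1) ^ 2)) := by
    have hid : Filter.Tendsto (fun s : ℝ => s) (nhdsWithin 1 (Iio 1)) (nhds 1) :=
      Filter.tendsto_id.mono_left nhdsWithin_le_nhds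
    exact (h.tendsto_one.div hid one_ne_zero).pow 2
  have := le_of_tendsto hlim (Filter.eventually_of_mem (Ioo_mem_nhdsLT hr.2) (fun s hs =>
    show (f s / s) ^ 2 ≤ d r ^ 2 + (f r / r) ^ 2 + k / 2 * (f r ^ 2 - 1) ^ 2 from ?_))
  · simpa using this
  · have h1 := hmono hr ⟨hr.1.trans hs.1, hs.2⟩ hs.1.le
    simp only at h1
    have hk := h.nonneg_coeff
    have : 0 ≤ d s ^ 2 + k / 2 * (f s ^ 2 - 1) ^ 2 := by positivity
    linarith

end IsRadialProfile

/-- Gradient of a radial vector field `q(|x|) x` in the plane. -/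
lemma sum_norm_sq_fderiv_radial {g : ℝ → ℝ} {g' : ℝ} {x : EuclideanSpace ℝ (Fin 2)} (hx : x ≠ 0)
    (hg : HasDerivAt g g' ‖x‖) :
    ∑ i : Fin 2, ‖fderiv ℝ (fun y : EuclideanSpace ℝ (Fin 2) => (g ‖y‖ / ‖y‖) • y) x
      (EuclideanSpace.single i (1:ℝ))‖ ^ 2 = g' ^ 2 + (g ‖x‖ / ‖x‖) ^ 2 := by
  have hr : ‖x‖ ≠ 0 := norm_ne_zero_iff.2 hx
  have hn : HasFDerivAt (fun y : EuclideanSpace ℝ (Fin 2) => ‖y‖)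
      (‖x‖⁻¹ • innerSL ℝ x) x := by
    have h1 := (hasStrictFDerivAt_norm_sq x).hasFDerivAt.sqrt (by positivity)
    simp only [Real.sqrt_sq (norm_nonneg _)] at h1
    refine h1.congr_fderiv ?_
    ext v
    simp
    field_simp
  have hq := (hg.div (hasDerivAt_id ‖x‖) hr).comp_hasFDerivAt x hn
  have hF := (hq.smul (hasFDerivAt_id x)).fderiv
  have hF' : fderiv ℝ (fun y : EuclideanSpace ℝ (Fin 2) => (g ‖y‖ / ‖y‖) • y) x = _ := hF
  have hns : ‖x‖ ^ 2 = x 0 ^ 2 + x 1 ^ 2 := by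
    rw [EuclideanSpace.norm_sq_eq]; simp
  have happ : ∀ i, fderiv ℝ (fun y : EuclideanSpace ℝ (Fin 2) => (g ‖y‖ / ‖y‖) • y) x
      (EuclideanSpace.single i (1:ℝ)) = (g ‖x‖ / ‖x‖) • EuclideanSpace.single i (1:ℝ)
        + ((g' * ‖x‖ - g ‖x‖) / ‖x‖ ^ 2 * ‖x‖⁻¹ * x i) • x := by
    intro i
    rw [hF']
    ext j
    simp [EuclideanSpace.inner_single_right]
    left
    ring
  rw [Fin.sum_univ_two, happ, happ]
  clear happ hF hF' hq hn hg
  generalize ‖x‖ = r at *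
  simp [EuclideanSpace.norm_sq_eq, Fin.sum_univ_two]
  field_simp
  linear_combination (-(2 * g r * r ^ 2 * (g' * r - g r)
    + (g' * r - g r) ^ 2 * (x 0 ^ 2 + x 1 ^ 2 + r ^ 2))) * hns

/-- Rearrangement: among sets of equal finite measure, the integral of `F` is largest on a set `t`
with `F ≥ c` on `t` and `F ≤ c` off `t`. -/
lemma setIntegral_le_of_le_of_ge {α : Type*} [MeasurableSpace α] {μ : Measure α} {s t : Set α}
    (hs : MeasurableSet s) (ht : MeasurableSet t) (hst : μ s = μ t) (htop : μ t ≠ ⊤) {F : α → ℝ}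
    (hFs : IntegrableOn F s μ) (hFt : IntegrableOn F t μ) {c : ℝ}
    (hge : ∀ᵐ x ∂μ, x ∈ t → c ≤ F x) (hle : ∀ᵐ x ∂μ, x ∉ t → F x ≤ c) :
    ∫ x in s, F x ∂μ ≤ ∫ x in t, F x ∂μ := by
  have hs' : μ s ≠ ⊤ := hst ▸ htop
  have hcs : IntegrableOn (fun _ => c) s μ := integrableOn_const hs'
  have hct : IntegrableOn (fun _ => c) t μ := integrableOn_const htop
  have key : ∫ x in s, (F x - c) ∂μ ≤ ∫ x in t, (F x - c) ∂μ := by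
    rw [← integral_indicator hs, ← integral_indicator ht]
    refine integral_mono_ae ((hFs.sub hcs).integrable_indicator hs)
      ((hFt.sub hct).integrable_indicator ht) ?_
    filter_upwards [hge, hle] with x h1 h2
    simp only [indicator]
    split_ifs with h3 h4 h4
    · rfl
    · linarith [h2 h4]
    · linarith [h1 h4]
    · rfl
  rw [integral_sub hFs hcs, integral_sub hFt hct] at key
  simp only [setIntegral_const, measureReal_def, hst] at key
  linarith

/-- The translated radial competitor `φ_ε(x) = f_ε(|x-p|)(x-p)/|x-p|` belongs to the
constraint class `K` and its energy on `Ω` is bounded by that of the radial solution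
on the unit disk. -/
theorem translated_competitor_bound
    (ε : ℝ) (hε : 0 < ε) (f : ℝ → ℝ)
    (hf : ContDiffOn ℝ 2 f (Ioo 0 1)) (hc : ContinuousOn f (Icc 0 1))
    (hf0 : f 0 = 0) (hf1 : f 1 = 1)
    (h01 : ∀ r ∈ Icc (0:ℝ) 1, 0 ≤ f r ∧ f r ≤ 1)
    (hf' : ∀ r ∈ Ioo (0:ℝ) 1, 0 < deriv f r)
    (hode : ∀ r ∈ Ioo (0:ℝ) 1,
      -(deriv (deriv f) r) - deriv f r / r + f r / r ^ 2
        = (1 / ε ^ 2) * f r * (1 - (f r) ^ 2))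
    (fext : ℝ → ℝ) (hfext : ∀ r : ℝ, fext r = if r ≤ 1 then f r else 1)
    (u : EuclideanSpace ℝ (Fin 2) → EuclideanSpace ℝ (Fin 2))
    (hu : ∀ x, u x = (f ‖x‖ / ‖x‖) • x)
    (Ω : Set (EuclideanSpace ℝ (Fin 2))) (hΩo : IsOpen Ω)
    (hΩb : Bornology.IsBounded Ω)
    (hvol : volume Ω = volume (Metric.ball (0 : EuclideanSpace ℝ (Fin 2)) 1))
    (p : EuclideanSpace ℝ (Fin 2))
    (φ : EuclideanSpace ℝ (Fin 2) → EuclideanSpace ℝ (Fin 2))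
    (hφ : ∀ x, φ x = (fext ‖x - p‖ / ‖x - p‖) • (x - p))
    (hp : (∫ x in Ω, φ x) = 0) :
    -- φ belongs to K :
    (∫ x in Ω, φ x) = 0 ∧
    (∫ x in Metric.ball (0 : EuclideanSpace ℝ (Fin 2)) 1, ‖u x‖ ^ 2)
      ≤ (∫ x in Ω, ‖φ x‖ ^ 2) ∧
    -- energy bound E_ε(φ, Ω) ≤ E_ε(u, B₁):
    (1/2) * (∫ x in Ω, ∑ i : Fin 2,
          ‖fderiv ℝ φ x (EuclideanSpace.single i (1:ℝ))‖ ^ 2)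
        + (1 / (4 * ε ^ 2)) * (∫ x in Ω, (‖φ x‖ ^ 2 - 1) ^ 2)
      ≤ (1/2) * (∫ x in Metric.ball (0 : EuclideanSpace ℝ (Fin 2)) 1,
            ∑ i : Fin 2, ‖fderiv ℝ u x (EuclideanSpace.single i (1:ℝ))‖ ^ 2)
        + (1 / (4 * ε ^ 2)) * (∫ x in Metric.ball (0 : EuclideanSpace ℝ (Fin 2)) 1,
            (‖u x‖ ^ 2 - 1) ^ 2) := by
  have hk : (0:ℝ) ≤ 1 / ε ^ 2 := by positivity
  have hprof : IsRadialProfile (1 / ε ^ 2) f (deriv f) := by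
    have hd : ∀ r ∈ Ioo (0:ℝ) 1, DifferentiableAt ℝ f r := fun r hr =>
      (hf.differentiableOn (by norm_num)).differentiableAt (isOpen_Ioo.mem_nhds hr)
    have hd2 : ∀ r ∈ Ioo (0:ℝ) 1, DifferentiableAt ℝ (deriv f) r := fun r hr =>
      ((hf.deriv_of_isOpen (m := 1) isOpen_Ioo (by norm_num)).differentiableOn
        (by norm_num)).differentiableAt (isOpen_Ioo.mem_nhds hr)
    refine ⟨hk, fun r hr => (h01 r (Ioo_subset_Icc_self hr)).1,
      fun r hr => (h01 r (Ioo_subset_Icc_self hr)).2, fun r hr => (hf' r hr).le,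
      fun r hr => (hd r hr).hasDerivAt, fun r hr => ?_, ?_⟩
    · refine (hd2 r hr).hasDerivAt.congr_deriv ?_
      linear_combination -(hode r hr)
    · have := (hc 1 (right_mem_Icc.2 zero_le_one)).tendsto
      rw [hf1] at this
      refine this.mono_left ?_
      rw [← nhdsWithin_Ioo_eq_nhdsLT (zero_lt_one (α := ℝ))]
      exact nhdsWithin_mono _ Ioo_subset_Icc_self
  set ψ : EuclideanSpace ℝ (Fin 2) → EuclideanSpace ℝ (Fin 2) :=
    fun y => (fext ‖y‖ / ‖y‖) • y with hψ
  have hφψ : φ = fun x => ψ (x - p) := funext hφ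
  have hext01 : ∀ r, 0 ≤ r → 0 ≤ fext r ∧ fext r ≤ 1 := by
    intro r hr
    rw [hfext]
    split_ifs with h
    · exact h01 r ⟨hr, h⟩
    · exact ⟨zero_le_one, le_rfl⟩
  have hnorm : ∀ y, ‖ψ y‖ = fext ‖y‖ := by
    intro y
    rcases eq_or_ne y 0 with rfl | hy
    · simp [hψ, hfext, hf0]
    · have hy' : ‖y‖ ≠ 0 := norm_ne_zero_iff.2 hy
      simp only [hψ, norm_smul, norm_div, norm_norm,
        Real.norm_of_nonneg (hext01 _ (norm_nonneg y)).1]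
      exact div_mul_cancel₀ _ hy'
  have hext_meas : Measurable fun y : EuclideanSpace ℝ (Fin 2) => fext ‖y‖ := by
    have h1 : Continuous fun r : ℝ => f (projIcc 0 1 zero_le_one r) :=
      (continuousOn_iff_continuous_domRestrict.1 hc).comp continuous_projIcc
    have h2 : (fun y : EuclideanSpace ℝ (Fin 2) => fext ‖y‖)
        = (fun r : ℝ => f (projIcc 0 1 zero_le_one r)) ∘ norm := by
      funext y
      rcases le_or_gt ‖y‖ 1 with h | h
      · simp [hfext, h, coe_projIcc]
      · simp [hfext, h.not_ge, projIcc_of_right_le _ h.le, hf1]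
    rw [h2]
    exact h1.measurable.comp measurable_norm
  set H : EuclideanSpace ℝ (Fin 2) → ℝ :=
    fun y => ∑ i : Fin 2, ‖fderiv ℝ ψ y (EuclideanSpace.single i (1:ℝ))‖ ^ 2 with hH
  set P : EuclideanSpace ℝ (Fin 2) → ℝ := fun y => (‖ψ y‖ ^ 2 - 1) ^ 2 with hP
  have hH_meas : Measurable H := by
    refine Finset.measurable_sum _ fun i _ => ?_
    exact (measurable_fderiv_apply_const ℝ ψ _).norm.pow_const 2
  have hN_meas : Measurable fun y => ‖ψ y‖ ^ 2 := by
    simp only [hnorm]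
    exact hext_meas.pow_const 2
  have hP_meas : Measurable P := (hN_meas.sub_const 1).pow_const 2
  have hH_in : ∀ y, y ≠ 0 → ‖y‖ < 1 → H y = deriv f ‖y‖ ^ 2 + (f ‖y‖ / ‖y‖) ^ 2 := by
    intro y hy hy1
    have hr : ‖y‖ ∈ Ioo (0:ℝ) 1 := ⟨norm_pos_iff.2 hy, hy1⟩
    have hd : HasDerivAt fext (deriv f ‖y‖) ‖y‖ := by
      refine (hprof.hasDerivAt _ hr).congr_of_eventuallyEq ?_
      filter_upwards [Iio_mem_nhds hy1] with s hs
      rw [hfext, if_pos (le_of_lt hs)]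
    simp only [hH, hψ]
    rw [sum_norm_sq_fderiv_radial hy hd, hfext, if_pos hy1.le]
  have hH_out : ∀ y, 1 < ‖y‖ → H y = (1 / ‖y‖) ^ 2 := by
    intro y hy1
    have hy : y ≠ 0 := norm_pos_iff.1 (zero_lt_one.trans hy1)
    have hd : HasDerivAt fext 0 ‖y‖ := by
      refine (hasDerivAt_const _ (1:ℝ)).congr_of_eventuallyEq ?_
      filter_upwards [Ioi_mem_nhds hy1] with s hs
      rw [hfext, if_neg (not_le.2 hs)]
    simp only [hH, hψ]
    rw [sum_norm_sq_fderiv_radial hy hd, hfext, if_neg (not_le.2 hy1)]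
    ring
  have hN_out : ∀ y, 1 < ‖y‖ → ‖ψ y‖ = 1 := by
    intro y hy
    rw [hnorm, hfext, if_neg (not_le.2 hy)]
  have hae : ∀ᵐ y : EuclideanSpace ℝ (Fin 2), y ≠ 0 ∧ ‖y‖ ≠ 1 := by
    have h1 : ∀ᵐ y : EuclideanSpace ℝ (Fin 2), y ≠ 0 := by
      simp [ae_iff]
    have h2 : ∀ᵐ y : EuclideanSpace ℝ (Fin 2), ‖y‖ ≠ 1 := by
      have := Measure.addHaar_sphere (volume : Measure (EuclideanSpace ℝ (Fin 2))) 0 1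
      simpa [ae_iff, Metric.sphere] using this
    exact h1.and h2
  have hout_le : ∀ y : EuclideanSpace ℝ (Fin 2), 1 < ‖y‖ → (1 / ‖y‖) ^ 2 ≤ 1 := by
    intro y hy
    refine pow_le_one₀ (by positivity) ?_
    rw [div_le_one (by linarith)]
    exact hy.le
  have hint : ∀ s : Set (EuclideanSpace ℝ (Fin 2)), volume s ≠ ⊤ →
      IntegrableOn H s ∧ IntegrableOn P s ∧ IntegrableOn (fun y => ‖ψ y‖ ^ 2) s := by
    intro s hs
    refine ⟨?_, ?_, ?_⟩
    · refine Measure.integrableOn_of_bounded (M := 2 * (1 + 1 / ε ^ 2 / 3) ^ 2) hs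
        hH_meas.aestronglyMeasurable (ae_restrict_of_ae ?_)
      filter_upwards [hae] with y ⟨hy, hy1⟩
      rw [Real.norm_of_nonneg (show 0 ≤ H y from Finset.sum_nonneg fun i _ => sq_nonneg _)]
      rcases lt_or_gt_of_ne hy1 with h | h
      · have hr : ‖y‖ ∈ Ioo (0:ℝ) 1 := ⟨norm_pos_iff.2 hy, h⟩
        rw [hH_in y hy h]
        have h1 := hprof.div_le hr
        have h2 := hprof.deriv_le_div hr
        have h3 := hprof.deriv_nonneg _ hr
        have h4 := pow_le_pow_left₀ h3 (h2.trans h1) 2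
        have h5 := pow_le_pow_left₀ (h3.trans h2) h1 2
        linarith
      · rw [hH_out y h]
        have := hout_le y h
        nlinarith
    · refine Measure.integrableOn_of_bounded (M := 1) hs
        hP_meas.aestronglyMeasurable (ae_of_all _ fun y => ?_)
      rw [Real.norm_of_nonneg (sq_nonneg _)]
      have := hext01 _ (norm_nonneg y)
      simp only [hnorm]
      have h1 : fext ‖y‖ ^ 2 ≤ 1 := pow_le_one₀ this.1 this.2
      nlinarith [sq_nonneg (fext ‖y‖)]
    · refine Measure.integrableOn_of_bounded (M := 1) hs
        hN_meas.aestronglyMeasurable (ae_of_all _ fun y => ?_)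
      rw [Real.norm_of_nonneg (sq_nonneg _), hnorm]
      have := hext01 _ (norm_nonneg y)
      exact pow_le_one₀ this.1 this.2
  have htrans : MeasurePreserving (fun x : EuclideanSpace ℝ (Fin 2) => x - p) :=
    measurePreserving_sub_right volume p
  have hemb : MeasurableEmbedding (fun x : EuclideanSpace ℝ (Fin 2) => x - p) :=
    (MeasurableEquiv.subRight p).measurableEmbedding
  set Ω' := (fun x : EuclideanSpace ℝ (Fin 2) => x - p) '' Ω with hΩ'
  have hpre : (fun x : EuclideanSpace ℝ (Fin 2) => x - p) ⁻¹' Ω' = Ω :=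
    hemb.injective.preimage_image Ω
  have hΩ'm : MeasurableSet Ω' := hemb.measurableSet_image.2 hΩo.measurableSet
  have hshift : ∀ F : EuclideanSpace ℝ (Fin 2) → ℝ,
      ∫ x in Ω, F (x - p) = ∫ y in Ω', F y := by
    intro F
    rw [← htrans.setIntegral_preimage_emb hemb F Ω', hpre]
  have hvol' : volume Ω' = volume (Metric.ball (0 : EuclideanSpace ℝ (Fin 2)) 1) := by
    rw [← hvol, ← htrans.measure_preimage_emb hemb, hpre]
  have hball : volume (Metric.ball (0 : EuclideanSpace ℝ (Fin 2)) 1) ≠ ⊤ :=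
    measure_ball_lt_top.ne
  have hΩ'top : volume Ω' ≠ ⊤ := hvol' ▸ hball
  obtain ⟨hHΩ, hPΩ, hNΩ⟩ := hint Ω' hΩ'top
  obtain ⟨hHB, hPB, hNB⟩ := hint _ hball
  have hu_eq : ∀ y ∈ Metric.ball (0 : EuclideanSpace ℝ (Fin 2)) 1, u y = ψ y := by
    intro y hy
    rw [mem_ball_zero_iff] at hy
    simp only [hu, hψ, hfext, if_pos hy.le]
  have hu_fderiv : ∀ y ∈ Metric.ball (0 : EuclideanSpace ℝ (Fin 2)) 1,
      fderiv ℝ u y = fderiv ℝ ψ y := fun y hy =>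
    Filter.EventuallyEq.fderiv_eq
      (Filter.eventually_of_mem (Metric.isOpen_ball.mem_nhds hy) hu_eq)
  have hφ_fderiv : ∀ x, fderiv ℝ φ x = fderiv ℝ ψ (x - p) := by
    intro x
    rw [hφψ, fderiv_comp_sub]
  refine ⟨hp, ?_, ?_⟩
  · have h1 : ∫ x in Ω, ‖φ x‖ ^ 2 = ∫ y in Ω', ‖ψ y‖ ^ 2 := by
      rw [← hshift, hφψ]
    have h2 : ∫ x in Metric.ball (0 : EuclideanSpace ℝ (Fin 2)) 1, ‖u x‖ ^ 2
        = ∫ x in Metric.ball (0 : EuclideanSpace ℝ (Fin 2)) 1, ‖ψ x‖ ^ 2 :=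
      setIntegral_congr_fun measurableSet_ball fun y hy => by simp only [hu_eq y hy]
    rw [h1, h2]
    have := setIntegral_le_of_le_of_ge (μ := volume) hΩ'm measurableSet_ball hvol' hball
      hNΩ.neg hNB.neg (c := -1) (ae_of_all _ fun y _ => ?_) ?_
    · simpa only [Pi.neg_apply, integral_neg, neg_le_neg_iff] using this
    · have := hext01 _ (norm_nonneg y)
      simp only [Pi.neg_apply, hnorm]
      exact neg_le_neg (pow_le_one₀ this.1 this.2)
    · filter_upwards [hae] with y ⟨_, hy1⟩ hyb
      rw [mem_ball_zero_iff, not_lt] at hyb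
      simp [hN_out y (lt_of_le_of_ne hyb (Ne.symm hy1))]
  · have h1 : (∫ x in Ω, ∑ i : Fin 2,
        ‖fderiv ℝ φ x (EuclideanSpace.single i (1:ℝ))‖ ^ 2) = ∫ y in Ω', H y := by
      rw [← hshift]
      simp only [hφ_fderiv, hH]
    have h2 : ∫ x in Ω, (‖φ x‖ ^ 2 - 1) ^ 2 = ∫ y in Ω', P y := by
      rw [← hshift, hφψ]
    have h3 : (∫ x in Metric.ball (0 : EuclideanSpace ℝ (Fin 2)) 1, ∑ i : Fin 2,
        ‖fderiv ℝ u x (EuclideanSpace.single i (1:ℝ))‖ ^ 2)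
        = ∫ x in Metric.ball (0 : EuclideanSpace ℝ (Fin 2)) 1, H x :=
      setIntegral_congr_fun measurableSet_ball fun y hy => by simp only [hu_fderiv y hy, hH]
    have h4 : ∫ x in Metric.ball (0 : EuclideanSpace ℝ (Fin 2)) 1, (‖u x‖ ^ 2 - 1) ^ 2
        = ∫ x in Metric.ball (0 : EuclideanSpace ℝ (Fin 2)) 1, P x :=
      setIntegral_congr_fun measurableSet_ball fun y hy => by simp only [hu_eq y hy, hP]
    rw [h1, h2, h3, h4]
    simp only [← integral_const_mul]
    rw [← integral_add (hHΩ.const_mul _) (hPΩ.const_mul _),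
      ← integral_add (hHB.const_mul _) (hPB.const_mul _)]
    refine setIntegral_le_of_le_of_ge hΩ'm measurableSet_ball hvol' hball
      ((hHΩ.const_mul _).add (hPΩ.const_mul _)) ((hHB.const_mul _).add (hPB.const_mul _))
      (c := 1 / 2) ?_ ?_
    · filter_upwards [hae] with y ⟨hy, _⟩ hyb
      rw [mem_ball_zero_iff] at hyb
      have hE := hprof.one_le_energy ⟨norm_pos_iff.2 hy, hyb⟩
      have hPy : P y = (f ‖y‖ ^ 2 - 1) ^ 2 := by
        simp only [hP, hnorm, hfext, if_pos hyb.le]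
      rw [hH_in y hy hyb, hPy]
      have hcoef : 1 / (4 * ε ^ 2) = 1 / 2 * (1 / ε ^ 2 / 2) := by ring
      rw [hcoef]
      linarith
    · filter_upwards [hae] with y ⟨_, hy1⟩ hyb
      rw [mem_ball_zero_iff, not_lt] at hyb
      have h := lt_of_le_of_ne hyb (Ne.symm hy1)
      have hPy : P y = 0 := by simp [hP, hN_out y h]
      rw [hH_out y h, hPy]
      have := hout_le y h
      linarith
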